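/- Suppose at least one coordinate of X has a continuous distribution function. If Y is completely separated relative to X, then Y perfectly depends on X, i.e. there exists a measurable function f : ℝ^p → ℝ with Y = f(X) almost surely. -/

import Mathlib

open MeasureTheory ProbabilityTheory Set

/-- The relative effect `Ψ(μ, ν) = ∫ μ((−∞,z)) + ½ μ({z}) dν(z)` of two
probability measures on `ℝ`. -/
noncomputable def relEffect (μ ν : Measure ℝ) : ℝ :=
  ∫ z, (μ (Set.Iio z)).toReal + (1 / 2) * (μ {z}).toReal ∂ν

/-- `Y` is completely separated relative to `X` if
`Ψ(ℙ^{Y|X=x₁}, ℙ^{Y|X=x₂}) ∈ {0, 1}` for `(ℙ^X ⊗ ℙ^X)`-almost all `(x₁, x₂)`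
with `x₁ ≠ x₂`. -/
def CompletelySeparated {Ω E : Type*} [MeasurableSpace Ω] [MeasurableSpace E]
    (μ : Measure Ω) [IsFiniteMeasure μ] (X : Ω → E) (Y : Ω → ℝ) : Prop :=
  ∀ᵐ q ∂((μ.map X).prod (μ.map X)), q.1 ≠ q.2 →
    relEffect (condDistrib Y X μ q.1) (condDistrib Y X μ q.2) ∈ ({0, 1} : Set ℝ)

lemma aux_integrand_le (μ : Measure ℝ) [IsProbabilityMeasure μ] (z : ℝ) :
    (μ (Set.Iio z)).toReal + (μ {z}).toReal = (μ (Set.Iic z)).toReal := by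
  rw [← ENNReal.toReal_add (measure_ne_top _ _) (measure_ne_top _ _),
    ← measure_union (by simp) (measurableSet_singleton z), Set.Iio_union_right]

lemma aux_Iic_le_one (μ : Measure ℝ) [IsProbabilityMeasure μ] (z : ℝ) :
    (μ (Set.Iic z)).toReal ≤ 1 := by
  have := ENNReal.toReal_mono ENNReal.one_ne_top (prob_le_one (μ := μ) (s := Set.Iic z))
  simpa using this

lemma aux_meas (μ : Measure ℝ) [IsProbabilityMeasure μ] :
    Measurable fun z => (μ (Set.Iio z)).toReal + (1 / 2) * (μ {z}).toReal := by
  have h1 : Monotone fun z => (μ (Set.Iio z)).toReal := fun a b h =>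
    ENNReal.toReal_mono (measure_ne_top _ _) (measure_mono (Set.Iio_subset_Iio h))
  have h2 : Monotone fun z => (μ (Set.Iic z)).toReal := fun a b h =>
    ENNReal.toReal_mono (measure_ne_top _ _) (measure_mono (Set.Iic_subset_Iic.2 h))
  have h3 : (fun z => (μ {z}).toReal) =
      fun z => (μ (Set.Iic z)).toReal - (μ (Set.Iio z)).toReal := by
    funext z; linarith [aux_integrand_le μ z]
  have h4 : Measurable fun z => (μ {z}).toReal := by
    rw [h3]; exact h2.measurable.sub h1.measurable
  exact h1.measurable.add (h4.const_mul _)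

lemma aux_int (μ ν : Measure ℝ) [IsProbabilityMeasure μ] [IsProbabilityMeasure ν] :
    Integrable (fun z => (μ (Set.Iio z)).toReal + (1 / 2) * (μ {z}).toReal) ν := by
  refine Integrable.of_bound (aux_meas μ).aestronglyMeasurable 1 (.of_forall fun z => ?_)
  have h1 : 0 ≤ (μ (Set.Iio z)).toReal := ENNReal.toReal_nonneg
  have h2 : 0 ≤ (μ {z}).toReal := ENNReal.toReal_nonneg
  rw [Real.norm_eq_abs, abs_of_nonneg (by positivity)]
  linarith [aux_integrand_le μ z, aux_Iic_le_one μ z]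

lemma aux_zero (μ ν : Measure ℝ) [IsProbabilityMeasure μ] [IsProbabilityMeasure ν]
    (h : relEffect μ ν = 0) : ∀ᵐ z ∂ν, (μ (Set.Iic z)).toReal = 0 := by
  unfold relEffect at h
  rw [integral_eq_zero_iff_of_nonneg (fun z => by positivity) (aux_int μ ν)] at h
  filter_upwards [h] with z hz
  have h1 : 0 ≤ (μ (Set.Iio z)).toReal := ENNReal.toReal_nonneg
  have h2 : 0 ≤ (μ {z}).toReal := ENNReal.toReal_nonneg
  simp only [Pi.zero_apply] at hz
  linarith [aux_integrand_le μ z]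

lemma aux_one (μ ν : Measure ℝ) [IsProbabilityMeasure μ] [IsProbabilityMeasure ν]
    (h : relEffect μ ν = 1) : ∀ᵐ z ∂ν, (μ (Set.Iic z)).toReal = 1 := by
  unfold relEffect at h
  have h0 : ∫ z, (1 - ((μ (Set.Iio z)).toReal + (1 / 2) * (μ {z}).toReal)) ∂ν = 0 := by
    rw [integral_sub (integrable_const _) (aux_int μ ν), h]; simp
  rw [integral_eq_zero_iff_of_nonneg ?_ (by exact (integrable_const _).sub (aux_int μ ν))] at h0
  · filter_upwards [h0] with z hz
    have h2 : 0 ≤ (μ {z}).toReal := ENNReal.toReal_nonneg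
    simp only [Pi.zero_apply] at hz
    linarith [aux_integrand_le μ z, aux_Iic_le_one μ z]
  · intro z
    have h2 : 0 ≤ (μ {z}).toReal := ENNReal.toReal_nonneg
    simp only [Pi.zero_apply]
    linarith [aux_integrand_le μ z, aux_Iic_le_one μ z]

lemma aux_exists (ν : Measure ℝ) (P : ℝ → Prop) (s : Set ℝ)
    (h : ∀ᵐ z ∂ν, P z) (hs : ν s ≠ 0) : ∃ z ∈ s, P z := by
  by_contra! hc
  exact hs (measure_mono_null (fun z hz => hc z hz) (ae_iff.1 h))

lemma aux_pair (μ ν : Measure ℝ) [IsProbabilityMeasure μ] [IsProbabilityMeasure ν]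
    (h : relEffect μ ν ∈ ({0, 1} : Set ℝ)) (q : ℝ)
    (hμ0 : μ (Iic q) ≠ 0) (hμ1 : μ (Iic q) ≠ 1)
    (hν0 : ν (Iic q) ≠ 0) (hν1 : ν (Iic q) ≠ 1) : False := by
  rcases h with h | h
  · have hs : ν (Ioi q) ≠ 0 := by
      rw [← compl_Iic]
      intro h'
      exact hν1 ((prob_compl_eq_zero_iff measurableSet_Iic).1 h')
    obtain ⟨z, hz, hz'⟩ := aux_exists ν _ _ (aux_zero μ ν h) hs
    rw [ENNReal.toReal_eq_zero_iff] at hz'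
    have := hz'.resolve_right (measure_ne_top _ _)
    exact hμ0 (measure_mono_null (Iic_subset_Iic.2 (le_of_lt hz)) this)
  · obtain ⟨z, hz, hz'⟩ := aux_exists ν _ _ (aux_one μ ν h) hν0
    rw [ENNReal.toReal_eq_one_iff] at hz'
    exact hμ1 (le_antisymm prob_le_one (hz' ▸ measure_mono (Iic_subset_Iic.2 hz)))

lemma aux_dirac (ν : Measure ℝ) [IsProbabilityMeasure ν]
    (h : ∀ q : ℚ, ν (Iic (q : ℝ)) = 0 ∨ ν (Iic (q : ℝ)) = 1) :
    ∀ᵐ z ∂ν, z = ∫ y, y ∂ν := by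
  have h1 : ∀ᵐ (z : ℝ) ∂ν, ∀ q : ℚ, (z ≤ (q : ℝ) ↔ ν (Iic (q : ℝ)) = 1) := by
    rw [ae_all_iff]
    intro q
    rcases h q with h0 | h0
    · have : ∀ᵐ z ∂ν, z ∉ Iic (q : ℝ) := measure_eq_zero_iff_ae_notMem.1 h0
      filter_upwards [this] with z hz
      simp only [h0, zero_ne_one, iff_false]; exact hz
    · have : ∀ᵐ z ∂ν, z ∈ Iic (q : ℝ) := (prob_compl_eq_zero_iff measurableSet_Iic).2 h0
      filter_upwards [this] with z hz
      simp only [h0, iff_true]; exact hz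
  obtain ⟨c, hc⟩ := h1.exists
  have h2 : ∀ᵐ z ∂ν, z = c := by
    filter_upwards [h1] with z hz
    have key : ∀ q : ℚ, (z ≤ q ↔ c ≤ q) := fun q => (hz q).trans (hc q).symm
    rcases lt_trichotomy z c with hlt | heq | hgt
    · obtain ⟨q, hq1, hq2⟩ := exists_rat_btwn hlt
      exact absurd ((key q).1 hq1.le) (not_le.2 hq2)
    · exact heq
    · obtain ⟨q, hq1, hq2⟩ := exists_rat_btwn hgt
      exact absurd ((key q).2 hq1.le) (not_le.2 hq2)
  have h3 : ∫ y, y ∂ν = c := by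
    rw [integral_congr_ae (g := fun _ => c) h2]; simp
  rw [h3]; exact h2

lemma aux_noAtom (ν : Measure ℝ) [IsProbabilityMeasure ν]
    (h : Continuous fun t : ℝ => (ν (Iic t)).toReal) (t : ℝ) : ν {t} = 0 := by
  have hc : Continuous (cdf ν) := by
    convert h using 2 with t
    rw [cdf_eq_real]; rfl
  rw [← measure_cdf ν, StieltjesFunction.measure_singleton,
    (hc.continuousAt.continuousWithinAt).leftLim_eq]
  simp

/-- If at least one coordinate of `X` has a continuous distribution function and `Y` is
completely separated relative to `X`, then `Y` perfectly depends on `X`: there is a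
measurable `f : ℝ^p → ℝ` with `Y = f(X)` almost surely. -/
theorem perfect_dependence_of_completely_separated {Ω : Type*} [MeasurableSpace Ω]
    {p : ℕ} (μ : Measure Ω) [IsProbabilityMeasure μ]
    (X : Ω → (Fin p → ℝ)) (Y : Ω → ℝ)
    (hX : Measurable X) (hY : Measurable Y)
    (hcont : ∃ i : Fin p, Continuous fun t : ℝ => (μ {ω | X ω i ≤ t}).toReal)
    (hsep : CompletelySeparated μ X Y) :
    ∃ f : (Fin p → ℝ) → ℝ, Measurable f ∧ Y =ᵐ[μ] fun ω => f (X ω) := by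
  obtain ⟨i, hi⟩ := hcont
  have hXi : Measurable fun ω => X ω i := (measurable_pi_apply i).comp hX
  have : IsProbabilityMeasure (μ.map X) := Measure.isProbabilityMeasure_map hX.aemeasurable
  have : IsProbabilityMeasure (μ.map fun ω => X ω i) :=
    Measure.isProbabilityMeasure_map hXi.aemeasurable
  have hatom : ∀ x, (μ.map X) {x} = 0 := by
    intro x
    have h1 := aux_noAtom (μ.map fun ω => X ω i) (by
      convert hi using 3 with t
      rw [Measure.map_apply hXi measurableSet_Iic]; rfl) (x i)
    rw [Measure.map_apply hXi (measurableSet_singleton _)] at h1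
    rw [Measure.map_apply hX (measurableSet_singleton _)]
    refine measure_mono_null (fun ω hω => ?_) h1
    simp only [mem_preimage, mem_singleton_iff] at hω ⊢
    rw [hω]
  have hdiag : ∀ᵐ q ∂((μ.map X).prod (μ.map X)), q.1 ≠ q.2 := by
    rw [ae_iff]
    have hm : MeasurableSet {q : (Fin p → ℝ) × (Fin p → ℝ) | ¬ q.1 ≠ q.2} := by
      simp only [ne_eq, not_not]
      exact measurableSet_eq_fun measurable_fst measurable_snd
    rw [Measure.measure_prod_null hm]
    refine .of_forall fun x => ?_
    refine measure_mono_null (fun y hy => ?_) (hatom x)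
    simp only [ne_eq, not_not, mem_preimage, mem_ofPred_eq] at hy
    exact hy.symm
  have hA : ∀ᵐ x ∂(μ.map X), ∀ q : ℚ, condDistrib Y X μ x (Iic (q : ℝ)) = 0 ∨
      condDistrib Y X μ x (Iic (q : ℝ)) = 1 := by
    rw [ae_all_iff]
    intro q
    rw [ae_iff]
    set A := {x | ¬ (condDistrib Y X μ x (Iic (q : ℝ)) = 0 ∨
      condDistrib Y X μ x (Iic (q : ℝ)) = 1)} with hAdef
    have hnull : ((μ.map X).prod (μ.map X)) (A ×ˢ A) = 0 := by
      refine measure_eq_zero_iff_ae_notMem.2 ?_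
      filter_upwards [hsep, hdiag] with r hr hne hmem
      obtain ⟨h1, h2⟩ := hmem
      simp only [hAdef, mem_ofPred_eq, not_or] at h1 h2
      exact aux_pair _ _ (hr hne) q h1.1 h1.2 h2.1 h2.2
    rw [Measure.prod_prod] at hnull
    exact mul_self_eq_zero.1 hnull
  have hf : Measurable fun x => ∫ y, y ∂(condDistrib Y X μ x) := by
    have : StronglyMeasurable fun x => ∫ y, (fun y : ℝ => y) y ∂(condDistrib Y X μ x) :=
      MeasureTheory.StronglyMeasurable.integral_kernel stronglyMeasurable_id
    exact this.measurable
  refine ⟨fun x => ∫ y, y ∂(condDistrib Y X μ x), hf, ?_⟩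
  have hjoint : ∀ᵐ r ∂((μ.map X) ⊗ₘ condDistrib Y X μ),
      r.2 = ∫ y, y ∂(condDistrib Y X μ r.1) := by
    rw [Measure.ae_compProd_iff (by
      exact measurableSet_eq_fun measurable_snd (hf.comp measurable_fst))]
    filter_upwards [hA] with x hx using aux_dirac _ hx
  rw [compProd_map_condDistrib hY.aemeasurable] at hjoint
  exact ae_of_ae_map (hX.prodMk hY).aemeasurable hjoint
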